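/- (Scalar invariance of I₆) Suppose (P,Q,R,S) on U and (P̃,Q̃,R̃,S̃) on Ũ are related by the point-transformation rule via φ, that F⁵ > 0 on U and F̃⁵ > 0 on Ũ, and let F = (F⁵)^{1/5}, F̃ = (F̃⁵)^{1/5}. Define I₆ = (A_{0.1} − B_{1.0})/(3·F²) − (A·F_{0.1} − B·F_{1.0})/(3·F³) and Ĩ₆ by the same formula from the tilde quantities. Then I₆ is a scalar invariant of the equation: I₆ = Ĩ₆∘φ on U. -/

import Mathlib

noncomputable section

open Real

/-- Partial derivative in the first argument (`f_{1.0}`). -/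
def pdx (f : ℝ → ℝ → ℝ) : ℝ → ℝ → ℝ := fun x y => deriv (fun t => f t y) x

/-- Partial derivative in the second argument (`f_{0.1}`). -/
def pdy (f : ℝ → ℝ → ℝ) : ℝ → ℝ → ℝ := fun x y => deriv (fun t => f x t) y

/-- Indexed partial derivative: `0 ↦ ∂/∂x`, `1 ↦ ∂/∂y`. -/
def pd (i : Fin 2) (f : ℝ → ℝ → ℝ) : ℝ → ℝ → ℝ := if i = 0 then pdx f else pdy f

/-- Smoothness of a two-variable real function on a set `U ⊆ ℝ²`. -/
def Smooth2 (U : Set (ℝ × ℝ)) (f : ℝ → ℝ → ℝ) : Prop :=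
  ContDiffOn ℝ (⊤ : ℕ∞) (Function.uncurry f) U

/-- The quantity `A` of formula (1.6). -/
def coefA (P Q R S : ℝ → ℝ → ℝ) : ℝ → ℝ → ℝ := fun x y =>
  pdy (pdy P) x y - 2 * pdx (pdy Q) x y + pdx (pdx R) x y
    + 2 * P x y * pdx S x y + S x y * pdx P x y
    - 3 * P x y * pdy R x y - 3 * R x y * pdy P x y
    - 3 * Q x y * pdx R x y + 6 * Q x y * pdy Q x y

/-- The quantity `B` of formula (1.6). -/
def coefB (P Q R S : ℝ → ℝ → ℝ) : ℝ → ℝ → ℝ := fun x y =>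
  pdx (pdx S) x y - 2 * pdx (pdy R) x y + pdy (pdy Q) x y
    - 2 * S x y * pdy P x y - P x y * pdy S x y
    + 3 * S x y * pdx Q x y + 3 * Q x y * pdx S x y
    + 3 * R x y * pdy Q x y - 6 * R x y * pdx R x y

/-- The quantity `G` of formula (2.4). -/
def coefG (P Q R S : ℝ → ℝ → ℝ) : ℝ → ℝ → ℝ := fun x y =>
  -(coefB P Q R S x y) * pdx (coefB P Q R S) x y
    - 3 * coefA P Q R S x y * pdy (coefB P Q R S) x y
    + 4 * coefB P Q R S x y * pdy (coefA P Q R S) x y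
    + 3 * S x y * (coefA P Q R S x y)^2
    - 6 * R x y * coefA P Q R S x y * coefB P Q R S x y
    + 3 * Q x y * (coefB P Q R S x y)^2

/-- The quantity `H` of formula (2.4). -/
def coefH (P Q R S : ℝ → ℝ → ℝ) : ℝ → ℝ → ℝ := fun x y =>
  -(coefA P Q R S x y) * pdy (coefA P Q R S) x y
    - 3 * coefB P Q R S x y * pdx (coefA P Q R S) x y
    + 4 * coefA P Q R S x y * pdx (coefB P Q R S) x y
    - 3 * P x y * (coefB P Q R S x y)^2
    + 6 * Q x y * coefA P Q R S x y * coefB P Q R S x y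
    - 3 * R x y * (coefA P Q R S x y)^2

/-- The quantity `F⁵` of formula (2.2). -/
def coefF5 (P Q R S : ℝ → ℝ → ℝ) : ℝ → ℝ → ℝ := fun x y =>
  coefA P Q R S x y * coefB P Q R S x y * pdy (coefA P Q R S) x y
    + coefA P Q R S x y * coefB P Q R S x y * pdx (coefB P Q R S) x y
    - (coefA P Q R S x y)^2 * pdy (coefB P Q R S) x y
    - (coefB P Q R S x y)^2 * pdx (coefA P Q R S) x y
    - P x y * (coefB P Q R S x y)^3
    + 3 * Q x y * coefA P Q R S x y * (coefB P Q R S x y)^2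
    - 3 * R x y * (coefA P Q R S x y)^2 * coefB P Q R S x y
    + S x y * (coefA P Q R S x y)^3

/-- The fully covariant symbol `θ_{ijk}` of (2.7) built from the ODE coefficients. -/
def thetaLow (P Q R S : ℝ → ℝ → ℝ) (i j k : Fin 2) : ℝ → ℝ → ℝ :=
  match i.1 + j.1 + k.1 with
  | 0 => P
  | 1 => Q
  | 2 => R
  | _ => S

/-- The symbol `θ^k_{ij}` of (2.8), obtained by raising the first index with `d^{kr}`. -/
def thetaUp (P Q R S : ℝ → ℝ → ℝ) (k i j : Fin 2) : ℝ → ℝ → ℝ :=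
  if k = 0 then thetaLow P Q R S 1 i j
  else fun x y => -(thetaLow P Q R S 0 i j x y)

/-- Jacobian matrix entry `T^p_i = ∂x̃^p/∂x^i` of the point transformation `φ = (xt, yt)`. -/
def Jmat (xt yt : ℝ → ℝ → ℝ) (p i : Fin 2) : ℝ → ℝ → ℝ :=
  pd i (if p = 0 then xt else yt)

/-- The Jacobian determinant `det T`. -/
def Jdet (xt yt : ℝ → ℝ → ℝ) : ℝ → ℝ → ℝ := fun x y =>
  Jmat xt yt 0 0 x y * Jmat xt yt 1 1 x y - Jmat xt yt 0 1 x y * Jmat xt yt 1 0 x y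

/-- The pointwise inverse Jacobian matrix `S = T⁻¹`. -/
def Jinv (xt yt : ℝ → ℝ → ℝ) (k m : Fin 2) : ℝ → ℝ → ℝ := fun x y =>
  (if k = 0 then (if m = 0 then Jmat xt yt 1 1 x y else -(Jmat xt yt 0 1 x y))
   else (if m = 0 then -(Jmat xt yt 1 0 x y) else Jmat xt yt 0 0 x y)) / Jdet xt yt x y

/-- `σ̃_i = ∂_i (det T) / det T`. -/
def sigmaT (xt yt : ℝ → ℝ → ℝ) (i : Fin 2) : ℝ → ℝ → ℝ := fun x y =>
  pd i (Jdet xt yt) x y / Jdet xt yt x y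

/-- The two coefficient systems are related by the point-transformation rule (2.9). -/
def PointRelated (U : Set (ℝ × ℝ)) (xt yt P Q R S Pt Qt Rt St : ℝ → ℝ → ℝ) : Prop :=
  ∀ i j k : Fin 2, ∀ x y : ℝ, (x, y) ∈ U →
    thetaUp P Q R S k i j x y =
      (∑ m : Fin 2, ∑ p : Fin 2, ∑ q : Fin 2,
        Jinv xt yt k m x y * Jmat xt yt p i x y * Jmat xt yt q j x y *
          thetaUp Pt Qt Rt St m p q (xt x y) (yt x y))
      + (∑ m : Fin 2, Jinv xt yt k m x y * pd j (Jmat xt yt m i) x y)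
      - (sigmaT xt yt i x y * (if k = j then (1:ℝ) else 0)
          + sigmaT xt yt j x y * (if k = i then (1:ℝ) else 0)) / 3

/-- The fifth root `F = (F⁵)^{1/5}` (real power), for the case of general position `F⁵ > 0`. -/
def frF (P Q R S : ℝ → ℝ → ℝ) : ℝ → ℝ → ℝ := fun x y =>
  (coefF5 P Q R S x y) ^ ((1:ℝ)/5)

/-- `φ₁ = −F_{1.0}/F`. -/
def phiGP1 (P Q R S : ℝ → ℝ → ℝ) : ℝ → ℝ → ℝ := fun x y =>
  -(pdx (frF P Q R S) x y / frF P Q R S x y)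

/-- `φ₂ = −F_{0.1}/F`. -/
def phiGP2 (P Q R S : ℝ → ℝ → ℝ) : ℝ → ℝ → ℝ := fun x y =>
  -(pdy (frF P Q R S) x y / frF P Q R S x y)

/-- The vector field `X = F⁻²·(B, −A)` of (3.4). -/
def frameX (P Q R S : ℝ → ℝ → ℝ) (k : Fin 2) : ℝ → ℝ → ℝ := fun x y =>
  (if k = 0 then coefB P Q R S x y else -(coefA P Q R S x y)) / (frF P Q R S x y)^2

/-- The vector field `Y = F⁻⁴·(G, H)` of (3.4). -/
def frameY (P Q R S : ℝ → ℝ → ℝ) (k : Fin 2) : ℝ → ℝ → ℝ := fun x y =>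
  (if k = 0 then coefG P Q R S x y else coefH P Q R S x y) / (frF P Q R S x y)^4

/-- The invariant `I₆` in the simplified form (3.11). -/
def inv6 (P Q R S : ℝ → ℝ → ℝ) : ℝ → ℝ → ℝ := fun x y =>
  (pdy (coefA P Q R S) x y - pdx (coefB P Q R S) x y) / (3 * (frF P Q R S x y)^2)
    - (coefA P Q R S x y * pdy (frF P Q R S) x y
        - coefB P Q R S x y * pdx (frF P Q R S) x y) / (3 * (frF P Q R S x y)^3)

/-- `f` has total derivative with partials `f1`, `f2` at `(x, y)`. -/
def HD (f : ℝ → ℝ → ℝ) (x y f1 f2 : ℝ) : Prop :=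
  HasFDerivAt (Function.uncurry f)
    (f1 • ContinuousLinearMap.fst ℝ ℝ ℝ + f2 • ContinuousLinearMap.snd ℝ ℝ ℝ) (x, y)

theorem HD.pdx {f : ℝ → ℝ → ℝ} {x y f1 f2 : ℝ} (h : HD f x y f1 f2) : pdx f x y = f1 := by
  have h1 : HasDerivAt (fun t : ℝ => (t, y)) ((1 : ℝ), (0 : ℝ)) x :=
    (hasDerivAt_id x).prodMk (hasDerivAt_const x y)
  have h' : HasFDerivAt (Function.uncurry f) _ ((fun t : ℝ => (t, y)) x) := h
  have := HasFDerivAt.comp_hasDerivAt x h' h1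
  have h2 := this.deriv
  simpa [_root_.pdx, Function.comp_def, Function.uncurry] using h2

theorem HD.pdy {f : ℝ → ℝ → ℝ} {x y f1 f2 : ℝ} (h : HD f x y f1 f2) : pdy f x y = f2 := by
  have h1 : HasDerivAt (fun t : ℝ => (x, t)) ((0 : ℝ), (1 : ℝ)) y :=
    (hasDerivAt_const y x).prodMk (hasDerivAt_id y)
  have h' : HasFDerivAt (Function.uncurry f) _ ((fun t : ℝ => (x, t)) y) := h
  have := HasFDerivAt.comp_hasDerivAt y h' h1
  have h2 := this.deriv
  simpa [_root_.pdy, Function.comp_def, Function.uncurry] using h2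

theorem HD.of_hasFDerivAt {f : ℝ → ℝ → ℝ} {x y : ℝ} {L : ℝ × ℝ →L[ℝ] ℝ}
    (h : HasFDerivAt (Function.uncurry f) L (x, y)) : HD f x y (L (1, 0)) (L (0, 1)) := by
  unfold HD
  convert h using 1
  ext <;> simp

theorem HD.of_smooth {U : Set (ℝ × ℝ)} (hU : IsOpen U) {f : ℝ → ℝ → ℝ} (hf : Smooth2 U f)
    {x y : ℝ} (hxy : (x, y) ∈ U) : HD f x y (_root_.pdx f x y) (_root_.pdy f x y) := by
  have h1 : DifferentiableAt ℝ (Function.uncurry f) (x, y) :=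
    (hf.contDiffAt (hU.mem_nhds hxy)).differentiableAt (by simp)
  have h2 := HD.of_hasFDerivAt h1.hasFDerivAt
  have e1 := h2.pdx
  have e2 := h2.pdy
  rw [e1, e2]
  exact h2

theorem HD.congr {U : Set (ℝ × ℝ)} (hU : IsOpen U) {f g : ℝ → ℝ → ℝ} {x y f1 f2 g1 g2 : ℝ}
    (hf : HD f x y f1 f2) (hg : HD g x y g1 g2) (hxy : (x, y) ∈ U)
    (h : ∀ x y, (x, y) ∈ U → f x y = g x y) : f1 = g1 ∧ f2 = g2 := by
  have hev : Function.uncurry f =ᶠ[nhds (x, y)] Function.uncurry g := by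
    filter_upwards [hU.mem_nhds hxy] with p hp
    exact h p.1 p.2 hp
  have h3 : HD f x y g1 g2 := HasFDerivAt.congr_of_eventuallyEq hg hev
  exact ⟨hf.pdx.symm.trans h3.pdx, hf.pdy.symm.trans h3.pdy⟩

theorem HD.cast {f : ℝ → ℝ → ℝ} {x y f1 f2 g1 g2 : ℝ}
    (hf : HD f x y f1 f2) (h1 : f1 = g1) (h2 : f2 = g2) : HD f x y g1 g2 := by
  subst h1 h2; exact hf

theorem HD.const (c x y : ℝ) : HD (fun _ _ => c) x y 0 0 := by
  have := HD.of_hasFDerivAt (f := fun _ _ => c) (x := x) (y := y) (L := 0)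
    (hasFDerivAt_const c (x, y))
  simpa using this

theorem HD.add {f g : ℝ → ℝ → ℝ} {x y f1 f2 g1 g2 : ℝ}
    (hf : HD f x y f1 f2) (hg : HD g x y g1 g2) :
    HD (fun x y => f x y + g x y) x y (f1 + g1) (f2 + g2) := by
  have := HD.of_hasFDerivAt (f := fun x y => f x y + g x y) (HasFDerivAt.add hf hg)
  simpa using this

theorem HD.sub {f g : ℝ → ℝ → ℝ} {x y f1 f2 g1 g2 : ℝ}
    (hf : HD f x y f1 f2) (hg : HD g x y g1 g2) :
    HD (fun x y => f x y - g x y) x y (f1 - g1) (f2 - g2) := by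
  have := HD.of_hasFDerivAt (f := fun x y => f x y - g x y) (HasFDerivAt.sub hf hg)
  simpa using this

theorem HD.neg {f : ℝ → ℝ → ℝ} {x y f1 f2 : ℝ}
    (hf : HD f x y f1 f2) : HD (fun x y => - f x y) x y (-f1) (-f2) := by
  have := HD.of_hasFDerivAt (f := fun x y => - f x y) (HasFDerivAt.neg hf)
  simpa using this

theorem HD.mul {f g : ℝ → ℝ → ℝ} {x y f1 f2 g1 g2 : ℝ}
    (hf : HD f x y f1 f2) (hg : HD g x y g1 g2) :
    HD (fun x y => f x y * g x y) x y (f1 * g x y + f x y * g1) (f2 * g x y + f x y * g2) := by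
  have := HD.of_hasFDerivAt (f := fun x y => f x y * g x y) (HasFDerivAt.mul hf hg)
  refine this.cast ?_ ?_ <;> simp <;> ring

theorem HD.comp {f u v : ℝ → ℝ → ℝ} {x y f1 f2 u1 u2 v1 v2 : ℝ}
    (hf : HD f (u x y) (v x y) f1 f2) (hu : HD u x y u1 u2) (hv : HD v x y v1 v2) :
    HD (fun x y => f (u x y) (v x y)) x y (f1 * u1 + f2 * v1) (f1 * u2 + f2 * v2) := by
  have h1 := HasFDerivAt.prodMk hu hv
  have h2 : HasFDerivAt (Function.uncurry f) _
    ((fun p : ℝ × ℝ => (Function.uncurry u p, Function.uncurry v p)) (x, y)) := hf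
  have h3 := HasFDerivAt.comp (x, y) h2 h1
  have := HD.of_hasFDerivAt (f := fun x y => f (u x y) (v x y)) h3
  refine this.cast ?_ ?_ <;> simp

theorem Smooth2.pdx {U : Set (ℝ × ℝ)} {f : ℝ → ℝ → ℝ} (hf : Smooth2 U f) (hU : IsOpen U) :
    Smooth2 U (pdx f) := by
  have h1 : ContDiffOn ℝ (⊤ : ℕ∞) (fun p => fderiv ℝ (Function.uncurry f) p (1, 0)) U :=
    (hf.fderiv_of_isOpen hU (m := (⊤ : ℕ∞)) (by simp)).clm_apply contDiffOn_const
  refine ContDiffOn.congr h1 ?_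
  rintro ⟨x, y⟩ hxy
  have h2 : DifferentiableAt ℝ (Function.uncurry f) (x, y) :=
    (hf.contDiffAt (hU.mem_nhds hxy)).differentiableAt (by simp)
  exact (HD.of_hasFDerivAt h2.hasFDerivAt).pdx

theorem Smooth2.pdy {U : Set (ℝ × ℝ)} {f : ℝ → ℝ → ℝ} (hf : Smooth2 U f) (hU : IsOpen U) :
    Smooth2 U (pdy f) := by
  have h1 : ContDiffOn ℝ (⊤ : ℕ∞) (fun p => fderiv ℝ (Function.uncurry f) p (0, 1)) U :=
    (hf.fderiv_of_isOpen hU (m := (⊤ : ℕ∞)) (by simp)).clm_apply contDiffOn_const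
  refine ContDiffOn.congr h1 ?_
  rintro ⟨x, y⟩ hxy
  have h2 : DifferentiableAt ℝ (Function.uncurry f) (x, y) :=
    (hf.contDiffAt (hU.mem_nhds hxy)).differentiableAt (by simp)
  exact (HD.of_hasFDerivAt h2.hasFDerivAt).pdy

theorem Smooth2.symm {U : Set (ℝ × ℝ)} {f : ℝ → ℝ → ℝ} (hf : Smooth2 U f) (hU : IsOpen U)
    {x y : ℝ} (hxy : (x, y) ∈ U) : _root_.pdx (_root_.pdy f) x y = _root_.pdy (_root_.pdx f) x y := by
  have hc : ContDiffAt ℝ (⊤ : ℕ∞) (Function.uncurry f) (x, y) := hf.contDiffAt (hU.mem_nhds hxy)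
  have hs : IsSymmSndFDerivAt ℝ (Function.uncurry f) (x, y) :=
    hc.isSymmSndFDerivAt (by simp; exact WithTop.coe_le_coe.2 (le_top : (2 : ℕ∞) ≤ ⊤))
  have hd : DifferentiableAt ℝ (fderiv ℝ (Function.uncurry f)) (x, y) :=
    (hc.fderiv_right (m := (⊤ : ℕ∞)) (by simp)).differentiableAt (by simp)
  have key : ∀ v : ℝ × ℝ, HasFDerivAt (fun p => fderiv ℝ (Function.uncurry f) p v)
      ((fderiv ℝ (fderiv ℝ (Function.uncurry f)) (x, y)).flip v) (x, y) := fun v => by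
    have := hd.hasFDerivAt.clm_apply (hasFDerivAt_const v (x, y))
    simpa using this
  have hk1 := HD.of_hasFDerivAt (f := fun x y => fderiv ℝ (Function.uncurry f) (x, y) (1, 0))
    (key (1, 0))
  have hk2 := HD.of_hasFDerivAt (f := fun x y => fderiv ℝ (Function.uncurry f) (x, y) (0, 1))
    (key (0, 1))
  have hdf : ∀ x y, (x, y) ∈ U → DifferentiableAt ℝ (Function.uncurry f) (x, y) :=
    fun x y h => (hf.contDiffAt (hU.mem_nhds h)).differentiableAt (by simp)
  have e1 := (HD.congr hU (HD.of_smooth hU (hf.pdx hU) hxy) hk1 hxy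
    fun x y h => (HD.of_hasFDerivAt (hdf x y h).hasFDerivAt).pdx).2
  have e2 := (HD.congr hU (HD.of_smooth hU (hf.pdy hU) hxy) hk2 hxy
    fun x y h => (HD.of_hasFDerivAt (hdf x y h).hasFDerivAt).pdy).1
  rw [e1, e2]
  exact hs (1, 0) (0, 1)

theorem Smooth2.const (U : Set (ℝ × ℝ)) (c : ℝ) : Smooth2 U (fun _ _ => c) :=
  contDiffOn_const

theorem Smooth2.add {U : Set (ℝ × ℝ)} {f g : ℝ → ℝ → ℝ} (hf : Smooth2 U f) (hg : Smooth2 U g) :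
    Smooth2 U (fun x y => f x y + g x y) := ContDiffOn.add hf hg

theorem Smooth2.sub {U : Set (ℝ × ℝ)} {f g : ℝ → ℝ → ℝ} (hf : Smooth2 U f) (hg : Smooth2 U g) :
    Smooth2 U (fun x y => f x y - g x y) := ContDiffOn.sub hf hg

theorem Smooth2.mul {U : Set (ℝ × ℝ)} {f g : ℝ → ℝ → ℝ} (hf : Smooth2 U f) (hg : Smooth2 U g) :
    Smooth2 U (fun x y => f x y * g x y) := ContDiffOn.mul hf hg

theorem Smooth2.neg {U : Set (ℝ × ℝ)} {f : ℝ → ℝ → ℝ} (hf : Smooth2 U f) :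
    Smooth2 U (fun x y => - f x y) := ContDiffOn.neg hf

theorem Smooth2.pow {U : Set (ℝ × ℝ)} {f : ℝ → ℝ → ℝ} (hf : Smooth2 U f) (n : ℕ) :
    Smooth2 U (fun x y => f x y ^ n) := ContDiffOn.pow hf n

theorem Smooth2.div {U : Set (ℝ × ℝ)} {f g : ℝ → ℝ → ℝ} (hf : Smooth2 U f) (hg : Smooth2 U g)
    (h : ∀ x y, (x, y) ∈ U → g x y ≠ 0) :
    Smooth2 U (fun x y => f x y / g x y) := ContDiffOn.div hf hg (fun p hp => h p.1 p.2 hp)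

theorem Smooth2.rpow {U : Set (ℝ × ℝ)} {f : ℝ → ℝ → ℝ} (hf : Smooth2 U f) (c : ℝ)
    (h : ∀ x y, (x, y) ∈ U → f x y ≠ 0) :
    Smooth2 U (fun x y => f x y ^ c) :=
  ContDiffOn.rpow_const_of_ne hf (fun p hp => h p.1 p.2 hp)

theorem Smooth2.coefA {U : Set (ℝ × ℝ)} (hU : IsOpen U) {P Q R S : ℝ → ℝ → ℝ}
    (hP : Smooth2 U P) (hQ : Smooth2 U Q) (hR : Smooth2 U R) (hS : Smooth2 U S) :
    Smooth2 U (coefA P Q R S) := by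
  unfold _root_.coefA
  repeat' first
    | assumption | exact hU | with_reducible apply Smooth2.add | with_reducible apply Smooth2.sub | with_reducible apply Smooth2.mul
    | with_reducible apply Smooth2.const | with_reducible apply Smooth2.pdx | with_reducible apply Smooth2.pdy

theorem Smooth2.coefB {U : Set (ℝ × ℝ)} (hU : IsOpen U) {P Q R S : ℝ → ℝ → ℝ}
    (hP : Smooth2 U P) (hQ : Smooth2 U Q) (hR : Smooth2 U R) (hS : Smooth2 U S) :
    Smooth2 U (coefB P Q R S) := by
  unfold _root_.coefB
  repeat' first
    | assumption | exact hU | with_reducible apply Smooth2.add | with_reducible apply Smooth2.sub | with_reducible apply Smooth2.mul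
    | with_reducible apply Smooth2.const | with_reducible apply Smooth2.pdx | with_reducible apply Smooth2.pdy

theorem Smooth2.coefF5 {U : Set (ℝ × ℝ)} (hU : IsOpen U) {P Q R S : ℝ → ℝ → ℝ}
    (hP : Smooth2 U P) (hQ : Smooth2 U Q) (hR : Smooth2 U R) (hS : Smooth2 U S) :
    Smooth2 U (coefF5 P Q R S) := by
  have hA := Smooth2.coefA hU hP hQ hR hS
  have hB := Smooth2.coefB hU hP hQ hR hS
  unfold _root_.coefF5
  repeat' first
    | assumption | exact hU | with_reducible apply Smooth2.add | with_reducible apply Smooth2.sub | with_reducible apply Smooth2.mul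
    | with_reducible apply Smooth2.const | with_reducible apply Smooth2.pow | with_reducible apply Smooth2.pdx | with_reducible apply Smooth2.pdy

theorem Smooth2.frF {U : Set (ℝ × ℝ)} (hU : IsOpen U) {P Q R S : ℝ → ℝ → ℝ}
    (hP : Smooth2 U P) (hQ : Smooth2 U Q) (hR : Smooth2 U R) (hS : Smooth2 U S)
    (hpos : ∀ x y : ℝ, (x, y) ∈ U → 0 < _root_.coefF5 P Q R S x y) :
    Smooth2 U (frF P Q R S) :=
  (Smooth2.coefF5 hU hP hQ hR hS).rpow _ fun x y h => (hpos x y h).ne'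

/-- Component `11` of the Ricci-type tensor of the traceless connection. -/
def ric11 (P Q R : ℝ → ℝ → ℝ) : ℝ → ℝ → ℝ := fun x y =>
  pdx Q x y - pdy P x y - 2 * (Q x y * Q x y) + 2 * (P x y * R x y)

/-- Component `12` of the Ricci-type tensor of the traceless connection. -/
def ric12 (P Q R S : ℝ → ℝ → ℝ) : ℝ → ℝ → ℝ := fun x y =>
  pdx R x y - pdy Q x y - Q x y * R x y + P x y * S x y

/-- Component `22` of the Ricci-type tensor of the traceless connection. -/
def ric22 (Q R S : ℝ → ℝ → ℝ) : ℝ → ℝ → ℝ := fun x y =>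
  pdx S x y - pdy R x y - 2 * (R x y * R x y) + 2 * (Q x y * S x y)

theorem HD.ric11 {U : Set (ℝ × ℝ)} (hU : IsOpen U) {P Q R : ℝ → ℝ → ℝ}
    (hP : Smooth2 U P) (hQ : Smooth2 U Q) (hR : Smooth2 U R)
    {x y : ℝ} (hxy : (x, y) ∈ U) :
    HD (ric11 P Q R) x y
      (_root_.pdx (_root_.pdx Q) x y - _root_.pdx (_root_.pdy P) x y
        - 4 * Q x y * _root_.pdx Q x y
        + 2 * (_root_.pdx P x y * R x y + P x y * _root_.pdx R x y))
      (_root_.pdx (_root_.pdy Q) x y - _root_.pdy (_root_.pdy P) x y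
        - 4 * Q x y * _root_.pdy Q x y
        + 2 * (_root_.pdy P x y * R x y + P x y * _root_.pdy R x y)) := by
  have dP := HD.of_smooth hU hP hxy
  have dQ := HD.of_smooth hU hQ hxy
  have dR := HD.of_smooth hU hR hxy
  have dQ1 := HD.of_smooth hU (hQ.pdx hU) hxy
  have dP2 := HD.of_smooth hU (hP.pdy hU) hxy
  refine ((((dQ1.sub dP2).sub ((HD.const 2 x y).mul (dQ.mul dQ))).add
    ((HD.const 2 x y).mul (dP.mul dR)))).cast ?_ ?_
  · ring
  · rw [hQ.symm hU hxy]; ring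

theorem HD.ric12 {U : Set (ℝ × ℝ)} (hU : IsOpen U) {P Q R S : ℝ → ℝ → ℝ}
    (hP : Smooth2 U P) (hQ : Smooth2 U Q) (hR : Smooth2 U R) (hS : Smooth2 U S)
    {x y : ℝ} (hxy : (x, y) ∈ U) :
    HD (ric12 P Q R S) x y
      (_root_.pdx (_root_.pdx R) x y - _root_.pdx (_root_.pdy Q) x y
        - (_root_.pdx Q x y * R x y + Q x y * _root_.pdx R x y)
        + (_root_.pdx P x y * S x y + P x y * _root_.pdx S x y))
      (_root_.pdx (_root_.pdy R) x y - _root_.pdy (_root_.pdy Q) x y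
        - (_root_.pdy Q x y * R x y + Q x y * _root_.pdy R x y)
        + (_root_.pdy P x y * S x y + P x y * _root_.pdy S x y)) := by
  have dP := HD.of_smooth hU hP hxy
  have dQ := HD.of_smooth hU hQ hxy
  have dR := HD.of_smooth hU hR hxy
  have dS := HD.of_smooth hU hS hxy
  have dR1 := HD.of_smooth hU (hR.pdx hU) hxy
  have dQ2 := HD.of_smooth hU (hQ.pdy hU) hxy
  refine ((dR1.sub dQ2).sub (dQ.mul dR)).add (dP.mul dS) |>.cast ?_ ?_
  · ring
  · rw [hR.symm hU hxy]

theorem HD.ric22 {U : Set (ℝ × ℝ)} (hU : IsOpen U) {Q R S : ℝ → ℝ → ℝ}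
    (hQ : Smooth2 U Q) (hR : Smooth2 U R) (hS : Smooth2 U S)
    {x y : ℝ} (hxy : (x, y) ∈ U) :
    HD (ric22 Q R S) x y
      (_root_.pdx (_root_.pdx S) x y - _root_.pdx (_root_.pdy R) x y
        - 4 * R x y * _root_.pdx R x y
        + 2 * (_root_.pdx Q x y * S x y + Q x y * _root_.pdx S x y))
      (_root_.pdx (_root_.pdy S) x y - _root_.pdy (_root_.pdy R) x y
        - 4 * R x y * _root_.pdy R x y
        + 2 * (_root_.pdy Q x y * S x y + Q x y * _root_.pdy S x y)) := by
  have dQ := HD.of_smooth hU hQ hxy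
  have dR := HD.of_smooth hU hR hxy
  have dS := HD.of_smooth hU hS hxy
  have dS1 := HD.of_smooth hU (hS.pdx hU) hxy
  have dR2 := HD.of_smooth hU (hR.pdy hU) hxy
  refine ((((dS1.sub dR2).sub ((HD.const 2 x y).mul (dR.mul dR))).add
    ((HD.const 2 x y).mul (dQ.mul dS)))).cast ?_ ?_
  · ring
  · rw [hS.symm hU hxy]; ring

/-- `A` is a component of the Cotton-type tensor of the traceless connection. -/
theorem coefA_eq {U : Set (ℝ × ℝ)} (hU : IsOpen U) {P Q R S : ℝ → ℝ → ℝ}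
    (hP : Smooth2 U P) (hQ : Smooth2 U Q) (hR : Smooth2 U R) (hS : Smooth2 U S)
    {x y : ℝ} (hxy : (x, y) ∈ U) :
    coefA P Q R S x y = pdx (ric12 P Q R S) x y - pdy (ric11 P Q R) x y
      + R x y * ric11 P Q R x y - 2 * Q x y * ric12 P Q R S x y + P x y * ric22 Q R S x y := by
  rw [(HD.ric11 hU hP hQ hR hxy).pdy, (HD.ric12 hU hP hQ hR hS hxy).pdx]
  simp only [ric11, ric12, ric22, coefA]
  ring

/-- `B` is a component of the Cotton-type tensor of the traceless connection. -/
theorem coefB_eq {U : Set (ℝ × ℝ)} (hU : IsOpen U) {P Q R S : ℝ → ℝ → ℝ}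
    (hP : Smooth2 U P) (hQ : Smooth2 U Q) (hR : Smooth2 U R) (hS : Smooth2 U S)
    {x y : ℝ} (hxy : (x, y) ∈ U) :
    coefB P Q R S x y = pdx (ric22 Q R S) x y - pdy (ric12 P Q R S) x y
      + S x y * ric11 P Q R x y - 2 * R x y * ric12 P Q R S x y + Q x y * ric22 Q R S x y := by
  rw [(HD.ric22 hU hQ hR hS hxy).pdx, (HD.ric12 hU hP hQ hR hS hxy).pdy]
  simp only [ric11, ric12, ric22, coefB]
  ring

/-- Mixed partials of a smooth function whose first partials are given on `U`. -/
theorem mixed_eq {U : Set (ℝ × ℝ)} (hU : IsOpen U) {f g h : ℝ → ℝ → ℝ} (hf : Smooth2 U f)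
    (hd : ∀ x y, (x, y) ∈ U → HD f x y (g x y) (h x y)) {x y g1 g2 h1 h2 : ℝ}
    (hxy : (x, y) ∈ U) (hg : HD g x y g1 g2) (hh : HD h x y h1 h2) : g2 = h1 := by
  have e1 := (HD.congr hU (HD.of_smooth hU (hf.pdx hU) hxy) hg hxy fun x y h => (hd x y h).pdx).2
  have e2 := (HD.congr hU (HD.of_smooth hU (hf.pdy hU) hxy) hh hxy fun x y h => (hd x y h).pdy).1
  rw [← e1, ← e2, hf.symm hU hxy]

theorem solve2 {a1 a2 b1 b2 X Y : ℝ} (hD : a1 * b2 - a2 * b1 ≠ 0)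
    (h1 : a1 * X + a2 * Y = 0) (h2 : b1 * X + b2 * Y = 0) : X = 0 ∧ Y = 0 := by
  constructor
  · refine (mul_eq_zero.1 (?_ : (a1 * b2 - a2 * b1) * X = 0)).resolve_left hD
    linear_combination b2 * h1 - a2 * h2
  · refine (mul_eq_zero.1 (?_ : (a1 * b2 - a2 * b1) * Y = 0)).resolve_left hD
    linear_combination a1 * h2 - b1 * h1

/-- Transformation law of the Ricci-type tensor: integrability of the system for second
derivatives of the point transformation. -/
theorem curv {U : Set (ℝ × ℝ)} (hU : IsOpen U)
    {a1 a2 b1 b2 s1 s2 P Q R S p q r w p1 p2 q1 q2 r1 r2 w1 w2 : ℝ → ℝ → ℝ}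
    (ha1 : Smooth2 U a1) (ha2 : Smooth2 U a2) (hb1 : Smooth2 U b1) (hb2 : Smooth2 U b2)
    (hs1 : Smooth2 U s1) (hs2 : Smooth2 U s2)
    (hP : Smooth2 U P) (hQ : Smooth2 U Q) (hR : Smooth2 U R) (hS : Smooth2 U S)
    (hD : ∀ x y, (x, y) ∈ U → a1 x y * b2 x y - a2 x y * b1 x y ≠ 0)
    (dp : ∀ x y, (x, y) ∈ U → HD p x y (p1 x y * a1 x y + p2 x y * b1 x y)
      (p1 x y * a2 x y + p2 x y * b2 x y))
    (dq : ∀ x y, (x, y) ∈ U → HD q x y (q1 x y * a1 x y + q2 x y * b1 x y)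
      (q1 x y * a2 x y + q2 x y * b2 x y))
    (dr : ∀ x y, (x, y) ∈ U → HD r x y (r1 x y * a1 x y + r2 x y * b1 x y)
      (r1 x y * a2 x y + r2 x y * b2 x y))
    (dw : ∀ x y, (x, y) ∈ U → HD w x y (w1 x y * a1 x y + w2 x y * b1 x y)
      (w1 x y * a2 x y + w2 x y * b2 x y))
    (da1 : ∀ x y, (x, y) ∈ U → HD a1 x y
      (a1 x y * (Q x y + 2 * s1 x y) - a2 x y * P x y - (q x y * (a1 x y * a1 x y)
        + 2 * (r x y * (a1 x y * b1 x y)) + w x y * (b1 x y * b1 x y)))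
      (a1 x y * (R x y + s2 x y) + a2 x y * (s1 x y - Q x y) - (q x y * (a1 x y * a2 x y)
        + r x y * (a1 x y * b2 x y + a2 x y * b1 x y) + w x y * (b1 x y * b2 x y))))
    (da2 : ∀ x y, (x, y) ∈ U → HD a2 x y
      (a1 x y * (R x y + s2 x y) + a2 x y * (s1 x y - Q x y) - (q x y * (a1 x y * a2 x y)
        + r x y * (a1 x y * b2 x y + a2 x y * b1 x y) + w x y * (b1 x y * b2 x y)))
      (a1 x y * S x y + a2 x y * (2 * s2 x y - R x y) - (q x y * (a2 x y * a2 x y)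
        + 2 * (r x y * (a2 x y * b2 x y)) + w x y * (b2 x y * b2 x y))))
    (db1 : ∀ x y, (x, y) ∈ U → HD b1 x y
      (b1 x y * (Q x y + 2 * s1 x y) - b2 x y * P x y + (p x y * (a1 x y * a1 x y)
        + 2 * (q x y * (a1 x y * b1 x y)) + r x y * (b1 x y * b1 x y)))
      (b1 x y * (R x y + s2 x y) + b2 x y * (s1 x y - Q x y) + (p x y * (a1 x y * a2 x y)
        + q x y * (a1 x y * b2 x y + a2 x y * b1 x y) + r x y * (b1 x y * b2 x y))))
    (db2 : ∀ x y, (x, y) ∈ U → HD b2 x y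
      (b1 x y * (R x y + s2 x y) + b2 x y * (s1 x y - Q x y) + (p x y * (a1 x y * a2 x y)
        + q x y * (a1 x y * b2 x y + a2 x y * b1 x y) + r x y * (b1 x y * b2 x y)))
      (b1 x y * S x y + b2 x y * (2 * s2 x y - R x y) + (p x y * (a2 x y * a2 x y)
        + 2 * (q x y * (a2 x y * b2 x y)) + r x y * (b2 x y * b2 x y))))
    {x y : ℝ} (hxy : (x, y) ∈ U) {t11 t12 t22 : ℝ}
    (ht11 : t11 = q1 x y - p2 x y - 2 * (q x y * q x y) + 2 * (p x y * r x y))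
    (ht12 : t12 = r1 x y - q2 x y - q x y * r x y + p x y * w x y)
    (ht22 : t22 = w1 x y - r2 x y - 2 * (r x y * r x y) + 2 * (q x y * w x y)) :
    ric11 P Q R x y = t11 * (a1 x y * a1 x y) + 2 * (t12 * (a1 x y * b1 x y))
        + t22 * (b1 x y * b1 x y)
        + pdx s1 x y - Q x y * s1 x y + P x y * s2 x y - s1 x y * s1 x y ∧
    ric12 P Q R S x y = t11 * (a1 x y * a2 x y) + t12 * (a1 x y * b2 x y + a2 x y * b1 x y)
        + t22 * (b1 x y * b2 x y)
        + pdy s1 x y - R x y * s1 x y + Q x y * s2 x y - s1 x y * s2 x y ∧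
    ric22 Q R S x y = t11 * (a2 x y * a2 x y) + 2 * (t12 * (a2 x y * b2 x y))
        + t22 * (b2 x y * b2 x y)
        + pdy s2 x y - S x y * s1 x y + R x y * s2 x y - s2 x y * s2 x y ∧
    pdx s2 x y = pdy s1 x y := by
  have xP := HD.of_smooth hU hP hxy
  have xQ := HD.of_smooth hU hQ hxy
  have xR := HD.of_smooth hU hR hxy
  have xS := HD.of_smooth hU hS hxy
  have xs1 := HD.of_smooth hU hs1 hxy
  have xs2 := HD.of_smooth hU hs2 hxy
  have xp := dp x y hxy
  have xq := dq x y hxy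
  have xr := dr x y hxy
  have xw := dw x y hxy
  have xa1 := da1 x y hxy
  have xa2 := da2 x y hxy
  have xb1 := db1 x y hxy
  have xb2 := db2 x y hxy
  have c2 := HD.const 2 x y
  have A11 := (((xa1.mul (xQ.add (c2.mul xs1))).sub (xa2.mul xP)).sub (((xq.mul (xa1.mul xa1)).add
    (c2.mul (xr.mul (xa1.mul xb1)))).add (xw.mul (xb1.mul xb1))))
  have A12 := (((xa1.mul (xR.add xs2)).add (xa2.mul (xs1.sub xQ))).sub
    (((xq.mul (xa1.mul xa2)).add
    (xr.mul ((xa1.mul xb2).add (xa2.mul xb1)))).add (xw.mul (xb1.mul xb2))))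
  have A22 := (((xa1.mul xS).add (xa2.mul ((c2.mul xs2).sub xR))).sub (((xq.mul (xa2.mul xa2)).add
    (c2.mul (xr.mul (xa2.mul xb2)))).add (xw.mul (xb2.mul xb2))))
  have B11 := (((xb1.mul (xQ.add (c2.mul xs1))).sub (xb2.mul xP)).add (((xp.mul (xa1.mul xa1)).add
    (c2.mul (xq.mul (xa1.mul xb1)))).add (xr.mul (xb1.mul xb1))))
  have B12 := (((xb1.mul (xR.add xs2)).add (xb2.mul (xs1.sub xQ))).add
    (((xp.mul (xa1.mul xa2)).add
    (xq.mul ((xa1.mul xb2).add (xa2.mul xb1)))).add (xr.mul (xb1.mul xb2))))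
  have B22 := (((xb1.mul xS).add (xb2.mul ((c2.mul xs2).sub xR))).add (((xp.mul (xa2.mul xa2)).add
    (c2.mul (xq.mul (xa2.mul xb2)))).add (xr.mul (xb2.mul xb2))))
  have ia1 := mixed_eq hU ha1 da1 hxy A11 A12
  have ia2 := mixed_eq hU ha2 da2 hxy A12 A22
  have ib1 := mixed_eq hU hb1 db1 hxy B11 B12
  have ib2 := mixed_eq hU hb2 db2 hxy B12 B22
  clear A11 A12 A22 B11 B12 B22 xP xQ xR xS xs1 xs2 xp xq xr xw xa1 xa2 xb1 xb2 c2 da1 da2 db1 db2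
  clear dp dq dr dw
  have hd := hD x y hxy
  simp only [ric11, ric12, ric22]
  generalize a1 x y = a1, a2 x y = a2, b1 x y = b1, b2 x y = b2, P x y = P0, Q x y = Q0,
    R x y = R0, S x y = S0, s1 x y = σ1, s2 x y = σ2, p x y = p, q x y = q, r x y = r,
    w x y = w, p1 x y = p1, p2 x y = p2, q1 x y = q1, q2 x y = q2, r1 x y = r1, r2 x y = r2,
    w1 x y = w1, w2 x y = w2 at *
  generalize pdx P x y = Px, pdy P x y = Py, pdx Q x y = Qx, pdy Q x y = Qy,
    pdx R x y = Rx, pdy R x y = Ry, pdx S x y = Sx, pdy S x y = Sy,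
    pdx s1 x y = s1x, pdy s1 x y = s1y, pdx s2 x y = s2x, pdy s2 x y = s2y at *
  obtain ⟨X1, Y1⟩ := solve2 hd
    (X := -(Rx - Qy + P0 * S0 - Q0 * R0 - 2 * s1y + s2x + R0 * σ1 - Q0 * σ2 + σ1 * σ2)
      + (t11 * (a1 * a2) + t12 * (a1 * b2 + a2 * b1) + t22 * (b1 * b2)))
    (Y := Qx - Py - 2 * Q0 ^ 2 + 2 * P0 * R0 - s1x + Q0 * σ1 - P0 * σ2 + σ1 ^ 2
      - (t11 * (a1 * a1) + 2 * (t12 * (a1 * b1)) + t22 * (b1 * b1)))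
    (by rw [ht11, ht12, ht22]; linear_combination ia1)
    (by rw [ht11, ht12, ht22]; linear_combination ib1)
  obtain ⟨X2, Y2⟩ := solve2 hd
    (X := -(Sx - Ry - 2 * R0 ^ 2 + 2 * Q0 * S0 - s2y - R0 * σ2 + S0 * σ1 + σ2 ^ 2)
      + (t11 * (a2 * a2) + 2 * (t12 * (a2 * b2)) + t22 * (b2 * b2)))
    (Y := Rx - Qy + P0 * S0 - Q0 * R0 + s1y - 2 * s2x + R0 * σ1 - Q0 * σ2 + σ1 * σ2
      - (t11 * (a1 * a2) + t12 * (a1 * b2 + a2 * b1) + t22 * (b1 * b2)))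
    (by rw [ht11, ht12, ht22]; linear_combination ia2)
    (by rw [ht11, ht12, ht22]; linear_combination ib2)
  refine ⟨?_, ?_, ?_, ?_⟩
  · linear_combination Y1
  · linear_combination (-2/3) * X1 + (1/3) * Y2
  · linear_combination -X2
  · linear_combination (-1/3) * X1 + (-1/3) * Y2

set_option maxHeartbeats 1000000 in
/-- Transformation law of the pair `(A, B)`. -/
theorem cotton {U : Set (ℝ × ℝ)} (hU : IsOpen U)
    {a1 a2 b1 b2 s1 s2 P Q R S p q r w t11 t12 t22 t111 t112 t121 t122 t221 t222 : ℝ → ℝ → ℝ}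
    (hs1 : Smooth2 U s1) (hs2 : Smooth2 U s2)
    (hP : Smooth2 U P) (hQ : Smooth2 U Q) (hR : Smooth2 U R) (hS : Smooth2 U S)
    (da1 : ∀ x y, (x, y) ∈ U → HD a1 x y
      (a1 x y * (Q x y + 2 * s1 x y) - a2 x y * P x y - (q x y * (a1 x y * a1 x y)
        + 2 * (r x y * (a1 x y * b1 x y)) + w x y * (b1 x y * b1 x y)))
      (a1 x y * (R x y + s2 x y) + a2 x y * (s1 x y - Q x y) - (q x y * (a1 x y * a2 x y)
        + r x y * (a1 x y * b2 x y + a2 x y * b1 x y) + w x y * (b1 x y * b2 x y))))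
    (da2 : ∀ x y, (x, y) ∈ U → HD a2 x y
      (a1 x y * (R x y + s2 x y) + a2 x y * (s1 x y - Q x y) - (q x y * (a1 x y * a2 x y)
        + r x y * (a1 x y * b2 x y + a2 x y * b1 x y) + w x y * (b1 x y * b2 x y)))
      (a1 x y * S x y + a2 x y * (2 * s2 x y - R x y) - (q x y * (a2 x y * a2 x y)
        + 2 * (r x y * (a2 x y * b2 x y)) + w x y * (b2 x y * b2 x y))))
    (db1 : ∀ x y, (x, y) ∈ U → HD b1 x y
      (b1 x y * (Q x y + 2 * s1 x y) - b2 x y * P x y + (p x y * (a1 x y * a1 x y)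
        + 2 * (q x y * (a1 x y * b1 x y)) + r x y * (b1 x y * b1 x y)))
      (b1 x y * (R x y + s2 x y) + b2 x y * (s1 x y - Q x y) + (p x y * (a1 x y * a2 x y)
        + q x y * (a1 x y * b2 x y + a2 x y * b1 x y) + r x y * (b1 x y * b2 x y))))
    (db2 : ∀ x y, (x, y) ∈ U → HD b2 x y
      (b1 x y * (R x y + s2 x y) + b2 x y * (s1 x y - Q x y) + (p x y * (a1 x y * a2 x y)
        + q x y * (a1 x y * b2 x y + a2 x y * b1 x y) + r x y * (b1 x y * b2 x y)))
      (b1 x y * S x y + b2 x y * (2 * s2 x y - R x y) + (p x y * (a2 x y * a2 x y)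
        + 2 * (q x y * (a2 x y * b2 x y)) + r x y * (b2 x y * b2 x y))))
    (dt11 : ∀ x y, (x, y) ∈ U → HD t11 x y (t111 x y * a1 x y + t112 x y * b1 x y)
      (t111 x y * a2 x y + t112 x y * b2 x y))
    (dt12 : ∀ x y, (x, y) ∈ U → HD t12 x y (t121 x y * a1 x y + t122 x y * b1 x y)
      (t121 x y * a2 x y + t122 x y * b2 x y))
    (dt22 : ∀ x y, (x, y) ∈ U → HD t22 x y (t221 x y * a1 x y + t222 x y * b1 x y)
      (t221 x y * a2 x y + t222 x y * b2 x y))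
    (E11 : ∀ x y, (x, y) ∈ U → ric11 P Q R x y = t11 x y * (a1 x y * a1 x y) + 2 * (t12 x y * (a1 x y * b1 x y))
        + t22 x y * (b1 x y * b1 x y)
        + pdx s1 x y - Q x y * s1 x y + P x y * s2 x y - s1 x y * s1 x y)
    (E12 : ∀ x y, (x, y) ∈ U → ric12 P Q R S x y = t11 x y * (a1 x y * a2 x y) + t12 x y * (a1 x y * b2 x y + a2 x y * b1 x y)
        + t22 x y * (b1 x y * b2 x y)
        + pdy s1 x y - R x y * s1 x y + Q x y * s2 x y - s1 x y * s2 x y)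
    (E22 : ∀ x y, (x, y) ∈ U → ric22 Q R S x y = t11 x y * (a2 x y * a2 x y) + 2 * (t12 x y * (a2 x y * b2 x y))
        + t22 x y * (b2 x y * b2 x y)
        + pdy s2 x y - S x y * s1 x y + R x y * s2 x y - s2 x y * s2 x y)
    (E0 : ∀ x y, (x, y) ∈ U → pdx s2 x y = pdy s1 x y)
    {x y : ℝ} (hxy : (x, y) ∈ U) {At Bt : ℝ}
    (hAt : At = t121 x y - t112 x y + r x y * t11 x y - 2 * q x y * t12 x y + p x y * t22 x y)
    (hBt : Bt = t221 x y - t122 x y + w x y * t11 x y - 2 * r x y * t12 x y + q x y * t22 x y) :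
    coefA P Q R S x y = (a1 x y * b2 x y - a2 x y * b1 x y) * (a1 x y * At + b1 x y * Bt) ∧
    coefB P Q R S x y = (a1 x y * b2 x y - a2 x y * b1 x y) * (a2 x y * At + b2 x y * Bt) := by
  have xP := HD.of_smooth hU hP hxy
  have xQ := HD.of_smooth hU hQ hxy
  have xR := HD.of_smooth hU hR hxy
  have xS := HD.of_smooth hU hS hxy
  have xs1 := HD.of_smooth hU hs1 hxy
  have xs2 := HD.of_smooth hU hs2 hxy
  have xs1x := HD.of_smooth hU (hs1.pdx hU) hxy
  have xs1y := HD.of_smooth hU (hs1.pdy hU) hxy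
  have xs2y := HD.of_smooth hU (hs2.pdy hU) hxy
  have xt11 := dt11 x y hxy
  have xt12 := dt12 x y hxy
  have xt22 := dt22 x y hxy
  have xa1 := da1 x y hxy
  have xa2 := da2 x y hxy
  have xb1 := db1 x y hxy
  have xb2 := db2 x y hxy
  have c2 := HD.const 2 x y
  have G11 := (((((((xt11.mul (xa1.mul xa1)).add (c2.mul (xt12.mul (xa1.mul xb1)))).add
    (xt22.mul (xb1.mul xb1))).add xs1x).sub (xQ.mul xs1)).add (xP.mul xs2)).sub (xs1.mul xs1))
  have G12 := (((((((xt11.mul (xa1.mul xa2)).add (xt12.mul ((xa1.mul xb2).add (xa2.mul xb1)))).add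
    (xt22.mul (xb1.mul xb2))).add xs1y).sub (xR.mul xs1)).add (xQ.mul xs2)).sub (xs1.mul xs2))
  have G22 := (((((((xt11.mul (xa2.mul xa2)).add (c2.mul (xt12.mul (xa2.mul xb2)))).add
    (xt22.mul (xb2.mul xb2))).add xs2y).sub (xS.mul xs1)).add (xR.mul xs2)).sub (xs2.mul xs2))
  have r11 := (HD.ric11 hU hP hQ hR hxy).congr hU G11 hxy E11
  have r12 := (HD.ric12 hU hP hQ hR hS hxy).congr hU G12 hxy E12
  have r22 := (HD.ric22 hU hQ hR hS hxy).congr hU G22 hxy E22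
  rw [← (HD.ric11 hU hP hQ hR hxy).pdy] at r11
  rw [← (HD.ric12 hU hP hQ hR hS hxy).pdx, ← (HD.ric12 hU hP hQ hR hS hxy).pdy] at r12
  rw [← (HD.ric22 hU hQ hR hS hxy).pdx] at r22
  have e11 := r11.2
  have e12 := r12.1
  have e12' := r12.2
  have e22 := r22.1
  have f11 := E11 x y hxy
  have f12 := E12 x y hxy
  have f22 := E22 x y hxy
  have f0 := E0 x y hxy
  have m1 := hs1.symm hU hxy
  have m2 : pdx (pdy s2) x y = pdy (pdy s1) x y := by
    rw [hs2.symm hU hxy]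
    exact ((HD.of_smooth hU (hs2.pdx hU) hxy).congr hU xs1y hxy E0).2
  rw [coefA_eq hU hP hQ hR hS hxy, coefB_eq hU hP hQ hR hS hxy]
  rw [m1, f0] at e12
  rw [m2, f0] at e22
  simp only [ric11, ric12, ric22] at f11 f12 f22 ⊢
  rw [e11, e12, e12', e22, hAt, hBt]
  constructor
  · linear_combination (R x y + s2 x y) * f11 + (-2 * Q x y - s1 x y) * f12 + P x y * f22
  · linear_combination S x y * f11 + (-2 * R x y + s2 x y) * f12 + (Q x y - s1 x y) * f22

/-- Derivatives of `(A, B)` and transformation law of `F⁵`. -/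
theorem F5law {U : Set (ℝ × ℝ)} (hU : IsOpen U)
    {a1 a2 b1 b2 s1 s2 P Q R S p q r w α β α1 α2 β1 β2 : ℝ → ℝ → ℝ}
    (hP : Smooth2 U P) (hQ : Smooth2 U Q) (hR : Smooth2 U R) (hS : Smooth2 U S)
    (da1 : ∀ x y, (x, y) ∈ U → HD a1 x y
      (a1 x y * (Q x y + 2 * s1 x y) - a2 x y * P x y - (q x y * (a1 x y * a1 x y)
        + 2 * (r x y * (a1 x y * b1 x y)) + w x y * (b1 x y * b1 x y)))
      (a1 x y * (R x y + s2 x y) + a2 x y * (s1 x y - Q x y) - (q x y * (a1 x y * a2 x y)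
        + r x y * (a1 x y * b2 x y + a2 x y * b1 x y) + w x y * (b1 x y * b2 x y))))
    (da2 : ∀ x y, (x, y) ∈ U → HD a2 x y
      (a1 x y * (R x y + s2 x y) + a2 x y * (s1 x y - Q x y) - (q x y * (a1 x y * a2 x y)
        + r x y * (a1 x y * b2 x y + a2 x y * b1 x y) + w x y * (b1 x y * b2 x y)))
      (a1 x y * S x y + a2 x y * (2 * s2 x y - R x y) - (q x y * (a2 x y * a2 x y)
        + 2 * (r x y * (a2 x y * b2 x y)) + w x y * (b2 x y * b2 x y))))
    (db1 : ∀ x y, (x, y) ∈ U → HD b1 x y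
      (b1 x y * (Q x y + 2 * s1 x y) - b2 x y * P x y + (p x y * (a1 x y * a1 x y)
        + 2 * (q x y * (a1 x y * b1 x y)) + r x y * (b1 x y * b1 x y)))
      (b1 x y * (R x y + s2 x y) + b2 x y * (s1 x y - Q x y) + (p x y * (a1 x y * a2 x y)
        + q x y * (a1 x y * b2 x y + a2 x y * b1 x y) + r x y * (b1 x y * b2 x y))))
    (db2 : ∀ x y, (x, y) ∈ U → HD b2 x y
      (b1 x y * (R x y + s2 x y) + b2 x y * (s1 x y - Q x y) + (p x y * (a1 x y * a2 x y)
        + q x y * (a1 x y * b2 x y + a2 x y * b1 x y) + r x y * (b1 x y * b2 x y)))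
      (b1 x y * S x y + b2 x y * (2 * s2 x y - R x y) + (p x y * (a2 x y * a2 x y)
        + 2 * (q x y * (a2 x y * b2 x y)) + r x y * (b2 x y * b2 x y))))
    (dα : ∀ x y, (x, y) ∈ U → HD α x y (α1 x y * a1 x y + α2 x y * b1 x y)
      (α1 x y * a2 x y + α2 x y * b2 x y))
    (dβ : ∀ x y, (x, y) ∈ U → HD β x y (β1 x y * a1 x y + β2 x y * b1 x y)
      (β1 x y * a2 x y + β2 x y * b2 x y))
    (hA : ∀ x y, (x, y) ∈ U → coefA P Q R S x y =
      (a1 x y * b2 x y - a2 x y * b1 x y) * (a1 x y * α x y + b1 x y * β x y))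
    (hB : ∀ x y, (x, y) ∈ U → coefB P Q R S x y =
      (a1 x y * b2 x y - a2 x y * b1 x y) * (a2 x y * α x y + b2 x y * β x y))
    {x y : ℝ} (hxy : (x, y) ∈ U) :
    (HD (fun x y => a1 x y * b2 x y - a2 x y * b1 x y) x y
      (3 * s1 x y * (a1 x y * b2 x y - a2 x y * b1 x y))
      (3 * s2 x y * (a1 x y * b2 x y - a2 x y * b1 x y))) ∧
    pdy (coefA P Q R S) x y - pdx (coefB P Q R S) x y
      = (a1 x y * b2 x y - a2 x y * b1 x y) *
        (3 * s2 x y * (a1 x y * α x y + b1 x y * β x y)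
          - 3 * s1 x y * (a2 x y * α x y + b2 x y * β x y)
          + (a1 x y * b2 x y - a2 x y * b1 x y) * (α2 x y - β1 x y)) ∧
    coefF5 P Q R S x y = (a1 x y * b2 x y - a2 x y * b1 x y) ^ 5 *
      (α x y * β x y * α2 x y + α x y * β x y * β1 x y - α x y ^ 2 * β2 x y - β x y ^ 2 * α1 x y
        - p x y * β x y ^ 3 + 3 * q x y * α x y * β x y ^ 2 - 3 * r x y * α x y ^ 2 * β x y
        + w x y * α x y ^ 3) := by
  have xa1 := da1 x y hxy
  have xa2 := da2 x y hxy
  have xb1 := db1 x y hxy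
  have xb2 := db2 x y hxy
  have xα := dα x y hxy
  have xβ := dβ x y hxy
  have xD : HD (fun x y => a1 x y * b2 x y - a2 x y * b1 x y) x y
      (3 * s1 x y * (a1 x y * b2 x y - a2 x y * b1 x y))
      (3 * s2 x y * (a1 x y * b2 x y - a2 x y * b1 x y)) := by
    refine ((xa1.mul xb2).sub (xa2.mul xb1)).cast ?_ ?_ <;> ring
  have gA := (HD.of_smooth hU (Smooth2.coefA hU hP hQ hR hS) hxy).congr hU
    (xD.mul ((xa1.mul xα).add (xb1.mul xβ))) hxy hA
  have gB := (HD.of_smooth hU (Smooth2.coefB hU hP hQ hR hS) hxy).congr hU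
    (xD.mul ((xa2.mul xα).add (xb2.mul xβ))) hxy hB
  refine ⟨xD, ?_, ?_⟩
  · rw [gA.2, gB.1]
    ring
  · simp only [coefF5]
    rw [gA.2, gB.1, gA.1, gB.2, hA x y hxy, hB x y hxy]
    ring

theorem invsolve {a1 a2 b1 b2 u v X Y : ℝ} (hD : a1 * b2 - a2 * b1 ≠ 0)
    (hu : u = (b2 * X - a2 * Y) / (a1 * b2 - a2 * b1))
    (hv : v = (a1 * Y - b1 * X) / (a1 * b2 - a2 * b1)) :
    X = a1 * u + a2 * v ∧ Y = b1 * u + b2 * v := by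
  rw [eq_div_iff hD] at hu hv
  constructor
  · refine mul_right_cancel₀ hD ?_
    linear_combination -a1 * hu - a2 * hv
  · refine mul_right_cancel₀ hD ?_
    linear_combination -b1 * hu - b2 * hv

/-- Comparison of the two expressions for `I₆`, once all transformation laws are known. -/
theorem final_alg {D F α β a1 a2 b1 b2 s1 s2 α2 β1 F1 F2 : ℝ} (hD : D ≠ 0) (hF : F ≠ 0)
    (hDe : D = a1 * b2 - a2 * b1) :
    (D * (3 * s2 * (a1 * α + b1 * β) - 3 * s1 * (a2 * α + b2 * β) + D * (α2 - β1)))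
        / (3 * (D * F) ^ 2)
      - (D * (a1 * α + b1 * β) * (3 * s2 * D * F + D * (F1 * a2 + F2 * b2))
        - D * (a2 * α + b2 * β) * (3 * s1 * D * F + D * (F1 * a1 + F2 * b1))) / (3 * (D * F) ^ 3)
      = (α2 - β1) / (3 * F ^ 2) - (α * F2 - β * F1) / (3 * F ^ 3) := by
  field_simp
  rw [hDe]
  ring

/-- Scalar invariance of `I₆`: under a point transformation, `I₆ = Ĩ₆ ∘ φ`. -/
theorem I6_scalar_invariant
    (U Ut : Set (ℝ × ℝ)) (hU : IsOpen U) (hUconn : IsConnected U) (hUt : IsOpen Ut)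
    (xt yt : ℝ → ℝ → ℝ) (hxt : Smooth2 U xt) (hyt : Smooth2 U yt)
    (hmaps : ∀ x y : ℝ, (x, y) ∈ U → (xt x y, yt x y) ∈ Ut)
    (hdet : ∀ x y : ℝ, (x, y) ∈ U → Jdet xt yt x y ≠ 0)
    (P Q R S Pt Qt Rt St : ℝ → ℝ → ℝ)
    (hP : Smooth2 U P) (hQ : Smooth2 U Q) (hR : Smooth2 U R) (hS : Smooth2 U S)
    (hPt : Smooth2 Ut Pt) (hQt : Smooth2 Ut Qt) (hRt : Smooth2 Ut Rt) (hSt : Smooth2 Ut St)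
    (hrel : PointRelated U xt yt P Q R S Pt Qt Rt St)
    (hpos : ∀ x y : ℝ, (x, y) ∈ U → 0 < coefF5 P Q R S x y)
    (hpost : ∀ x y : ℝ, (x, y) ∈ Ut → 0 < coefF5 Pt Qt Rt St x y) :
    ∀ x y : ℝ, (x, y) ∈ U →
      inv6 P Q R S x y = inv6 Pt Qt Rt St (xt x y) (yt x y) := by
  have ha1 : Smooth2 U (pdx xt) := hxt.pdx hU
  have ha2 : Smooth2 U (pdy xt) := hxt.pdy hU
  have hb1 : Smooth2 U (pdx yt) := hyt.pdx hU
  have hb2 : Smooth2 U (pdy yt) := hyt.pdy hU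
  have hJ : Jdet xt yt = fun x y => pdx xt x y * pdy yt x y - pdy xt x y * pdx yt x y := by
    funext x y; simp [Jdet, Jmat, pd]
  have hD : ∀ x y, (x, y) ∈ U → pdx xt x y * pdy yt x y - pdy xt x y * pdx yt x y ≠ 0 := by
    intro x y h
    have := hdet x y h
    rwa [hJ] at this
  have hJs : Smooth2 U (Jdet xt yt) := by
    rw [hJ]; exact (ha1.mul hb2).sub (ha2.mul hb1)
  obtain ⟨s1, hs1d⟩ : ∃ s1 : ℝ → ℝ → ℝ, s1 = fun x y => sigmaT xt yt 0 x y / 3 := ⟨_, rfl⟩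
  obtain ⟨s2, hs2d⟩ : ∃ s2 : ℝ → ℝ → ℝ, s2 = fun x y => sigmaT xt yt 1 x y / 3 := ⟨_, rfl⟩
  have hs1 : Smooth2 U s1 := by
    rw [hs1d]
    exact ((hJs.pdx hU).div hJs hdet).div (Smooth2.const U 3) (fun _ _ _ => by norm_num)
  have hs2 : Smooth2 U s2 := by
    rw [hs2d]
    exact ((hJs.pdy hU).div hJs hdet).div (Smooth2.const U 3) (fun _ _ _ => by norm_num)
  have hsig1 : ∀ x y, sigmaT xt yt 0 x y = 3 * s1 x y := by
    intro x y; rw [hs1d]; ring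
  have hsig2 : ∀ x y, sigmaT xt yt 1 x y = 3 * s2 x y := by
    intro x y; rw [hs2d]; ring
  -- composition with the point transformation
  have hcomp : ∀ f : ℝ → ℝ → ℝ, Smooth2 Ut f → ∀ x y, (x, y) ∈ U →
      HD (fun x y => f (xt x y) (yt x y)) x y
        (pdx f (xt x y) (yt x y) * pdx xt x y + pdy f (xt x y) (yt x y) * pdx yt x y)
        (pdx f (xt x y) (yt x y) * pdy xt x y + pdy f (xt x y) (yt x y) * pdy yt x y) :=
    fun f hf x y h => (HD.of_smooth hUt hf (hmaps x y h)).comp (HD.of_smooth hU hxt h)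
      (HD.of_smooth hU hyt h)
  -- second derivatives of the point transformation
  have hrel' : ∀ x y, (x, y) ∈ U → ∀ i j,
      (∀ k, thetaUp P Q R S k i j x y =
      (∑ m : Fin 2, ∑ p : Fin 2, ∑ q : Fin 2,
        Jinv xt yt k m x y * Jmat xt yt p i x y * Jmat xt yt q j x y *
          thetaUp Pt Qt Rt St m p q (xt x y) (yt x y))
      + (∑ m : Fin 2, Jinv xt yt k m x y * pd j (Jmat xt yt m i) x y)
      - (sigmaT xt yt i x y * (if k = j then (1:ℝ) else 0)
          + sigmaT xt yt j x y * (if k = i then (1:ℝ) else 0)) / 3) :=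
    fun x y h i j k => hrel i j k x y h
  have h11 : ∀ x y, (x, y) ∈ U → _ ∧ _ := fun x y h =>
    And.intro (hrel' x y h 0 0 0) (hrel' x y h 0 0 1)
  have h12 : ∀ x y, (x, y) ∈ U → _ ∧ _ := fun x y h =>
    And.intro (hrel' x y h 0 1 0) (hrel' x y h 0 1 1)
  have h21 : ∀ x y, (x, y) ∈ U → _ ∧ _ := fun x y h =>
    And.intro (hrel' x y h 1 0 0) (hrel' x y h 1 0 1)
  have h22 : ∀ x y, (x, y) ∈ U → _ ∧ _ := fun x y h =>
    And.intro (hrel' x y h 1 1 0) (hrel' x y h 1 1 1)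
  simp only [Fin.sum_univ_two, thetaUp, thetaLow, Jinv, Jmat, pd, hsig1, hsig2, hJ] at h11 h12 h21 h22
  simp at h11 h12 h21 h22
  have k11 := fun x y (h : (x, y) ∈ U) => invsolve (hD x y h) (u := Q x y + 2 * s1 x y) (v := -P x y)
    (X := pdx (pdx xt) x y + (Qt (xt x y) (yt x y) * (pdx xt x y * pdx xt x y)
      + 2 * (Rt (xt x y) (yt x y) * (pdx xt x y * pdx yt x y)) + St (xt x y) (yt x y) * (pdx yt x y * pdx yt x y)))
    (Y := pdx (pdx yt) x y - (Pt (xt x y) (yt x y) * (pdx xt x y * pdx xt x y)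
      + 2 * (Qt (xt x y) (yt x y) * (pdx xt x y * pdx yt x y)) + Rt (xt x y) (yt x y) * (pdx yt x y * pdx yt x y)))
    (by linear_combination (h11 x y h).1) (by linear_combination (h11 x y h).2)
  have k12 := fun x y (h : (x, y) ∈ U) => invsolve (hD x y h) (u := R x y + s2 x y) (v := s1 x y - Q x y)
    (X := pdy (pdx xt) x y + (Qt (xt x y) (yt x y) * (pdx xt x y * pdy xt x y)
      + Rt (xt x y) (yt x y) * (pdx xt x y * pdy yt x y + pdy xt x y * pdx yt x y) + St (xt x y) (yt x y) * (pdx yt x y * pdy yt x y)))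
    (Y := pdy (pdx yt) x y - (Pt (xt x y) (yt x y) * (pdx xt x y * pdy xt x y)
      + Qt (xt x y) (yt x y) * (pdx xt x y * pdy yt x y + pdy xt x y * pdx yt x y) + Rt (xt x y) (yt x y) * (pdx yt x y * pdy yt x y)))
    (by linear_combination (h12 x y h).1) (by linear_combination (h12 x y h).2)
  have k21 := fun x y (h : (x, y) ∈ U) => invsolve (hD x y h) (u := R x y + s2 x y) (v := s1 x y - Q x y)
    (X := pdx (pdy xt) x y + (Qt (xt x y) (yt x y) * (pdx xt x y * pdy xt x y)
      + Rt (xt x y) (yt x y) * (pdx xt x y * pdy yt x y + pdy xt x y * pdx yt x y) + St (xt x y) (yt x y) * (pdx yt x y * pdy yt x y)))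
    (Y := pdx (pdy yt) x y - (Pt (xt x y) (yt x y) * (pdx xt x y * pdy xt x y)
      + Qt (xt x y) (yt x y) * (pdx xt x y * pdy yt x y + pdy xt x y * pdx yt x y) + Rt (xt x y) (yt x y) * (pdx yt x y * pdy yt x y)))
    (by linear_combination (h21 x y h).1) (by linear_combination (h21 x y h).2)
  have k22 := fun x y (h : (x, y) ∈ U) => invsolve (hD x y h) (u := S x y) (v := 2 * s2 x y - R x y)
    (X := pdy (pdy xt) x y + (Qt (xt x y) (yt x y) * (pdy xt x y * pdy xt x y)
      + 2 * (Rt (xt x y) (yt x y) * (pdy xt x y * pdy yt x y)) + St (xt x y) (yt x y) * (pdy yt x y * pdy yt x y)))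
    (Y := pdy (pdy yt) x y - (Pt (xt x y) (yt x y) * (pdy xt x y * pdy xt x y)
      + 2 * (Qt (xt x y) (yt x y) * (pdy xt x y * pdy yt x y)) + Rt (xt x y) (yt x y) * (pdy yt x y * pdy yt x y)))
    (by linear_combination (h22 x y h).1) (by linear_combination (h22 x y h).2)
  clear h11 h12 h21 h22 hrel'
  have da1 : ∀ x y, (x, y) ∈ U → HD (pdx xt) x y
      (pdx xt x y * (Q x y + 2 * s1 x y) - pdy xt x y * P x y - (Qt (xt x y) (yt x y) * (pdx xt x y * pdx xt x y)
      + 2 * (Rt (xt x y) (yt x y) * (pdx xt x y * pdx yt x y)) + St (xt x y) (yt x y) * (pdx yt x y * pdx yt x y)))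
      (pdx xt x y * (R x y + s2 x y) + pdy xt x y * (s1 x y - Q x y) - (Qt (xt x y) (yt x y) * (pdx xt x y * pdy xt x y)
      + Rt (xt x y) (yt x y) * (pdx xt x y * pdy yt x y + pdy xt x y * pdx yt x y) + St (xt x y) (yt x y) * (pdx yt x y * pdy yt x y))) := fun x y h =>
    (HD.of_smooth hU ha1 h).cast (by linear_combination (k11 x y h).1)
      (by linear_combination (k12 x y h).1)
  have da2 : ∀ x y, (x, y) ∈ U → HD (pdy xt) x y
      (pdx xt x y * (R x y + s2 x y) + pdy xt x y * (s1 x y - Q x y) - (Qt (xt x y) (yt x y) * (pdx xt x y * pdy xt x y)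
      + Rt (xt x y) (yt x y) * (pdx xt x y * pdy yt x y + pdy xt x y * pdx yt x y) + St (xt x y) (yt x y) * (pdx yt x y * pdy yt x y)))
      (pdx xt x y * S x y + pdy xt x y * (2 * s2 x y - R x y) - (Qt (xt x y) (yt x y) * (pdy xt x y * pdy xt x y)
      + 2 * (Rt (xt x y) (yt x y) * (pdy xt x y * pdy yt x y)) + St (xt x y) (yt x y) * (pdy yt x y * pdy yt x y))) := fun x y h =>
    (HD.of_smooth hU ha2 h).cast (by linear_combination (k21 x y h).1)
      (by linear_combination (k22 x y h).1)
  have db1 : ∀ x y, (x, y) ∈ U → HD (pdx yt) x y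
      (pdx yt x y * (Q x y + 2 * s1 x y) - pdy yt x y * P x y + (Pt (xt x y) (yt x y) * (pdx xt x y * pdx xt x y)
      + 2 * (Qt (xt x y) (yt x y) * (pdx xt x y * pdx yt x y)) + Rt (xt x y) (yt x y) * (pdx yt x y * pdx yt x y)))
      (pdx yt x y * (R x y + s2 x y) + pdy yt x y * (s1 x y - Q x y) + (Pt (xt x y) (yt x y) * (pdx xt x y * pdy xt x y)
      + Qt (xt x y) (yt x y) * (pdx xt x y * pdy yt x y + pdy xt x y * pdx yt x y) + Rt (xt x y) (yt x y) * (pdx yt x y * pdy yt x y))) := fun x y h =>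
    (HD.of_smooth hU hb1 h).cast (by linear_combination (k11 x y h).2)
      (by linear_combination (k12 x y h).2)
  have db2 : ∀ x y, (x, y) ∈ U → HD (pdy yt) x y
      (pdx yt x y * (R x y + s2 x y) + pdy yt x y * (s1 x y - Q x y) + (Pt (xt x y) (yt x y) * (pdx xt x y * pdy xt x y)
      + Qt (xt x y) (yt x y) * (pdx xt x y * pdy yt x y + pdy xt x y * pdx yt x y) + Rt (xt x y) (yt x y) * (pdx yt x y * pdy yt x y)))
      (pdx yt x y * S x y + pdy yt x y * (2 * s2 x y - R x y) + (Pt (xt x y) (yt x y) * (pdy xt x y * pdy xt x y)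
      + 2 * (Qt (xt x y) (yt x y) * (pdy xt x y * pdy yt x y)) + Rt (xt x y) (yt x y) * (pdy yt x y * pdy yt x y))) := fun x y h =>
    (HD.of_smooth hU hb2 h).cast (by linear_combination (k21 x y h).2)
      (by linear_combination (k22 x y h).2)
  have hc := fun x y (h : (x, y) ∈ U) => curv hU (a1 := pdx xt) (a2 := pdy xt) (b1 := pdx yt) (b2 := pdy yt) (s1 := s1) (s2 := s2)
    (p := (fun x y => Pt (xt x y) (yt x y))) (q := (fun x y => Qt (xt x y) (yt x y))) (r := (fun x y => Rt (xt x y) (yt x y))) (w := (fun x y => St (xt x y) (yt x y)))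
    (p1 := (fun x y => pdx Pt (xt x y) (yt x y))) (p2 := (fun x y => pdy Pt (xt x y) (yt x y)))
    (q1 := (fun x y => pdx Qt (xt x y) (yt x y))) (q2 := (fun x y => pdy Qt (xt x y) (yt x y)))
    (r1 := (fun x y => pdx Rt (xt x y) (yt x y))) (r2 := (fun x y => pdy Rt (xt x y) (yt x y)))
    (w1 := (fun x y => pdx St (xt x y) (yt x y))) (w2 := (fun x y => pdy St (xt x y) (yt x y)))
    ha1 ha2 hb1 hb2 hs1 hs2 hP hQ hR hS hD (hcomp Pt hPt) (hcomp Qt hQt) (hcomp Rt hRt)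
    (hcomp St hSt) da1 da2 db1 db2 h (t11 := ric11 Pt Qt Rt (xt x y) (yt x y))
    (t12 := ric12 Pt Qt Rt St (xt x y) (yt x y)) (t22 := ric22 Qt Rt St (xt x y) (yt x y))
    rfl rfl rfl
  have hr11 : ∀ f : ℝ → ℝ → ℝ, ∀ x y, (x, y) ∈ U →
      (∃ u v, HD f (xt x y) (yt x y) u v) → HD (fun x y => f (xt x y) (yt x y)) x y
        (pdx f (xt x y) (yt x y) * pdx xt x y + pdy f (xt x y) (yt x y) * pdx yt x y)
        (pdx f (xt x y) (yt x y) * pdy xt x y + pdy f (xt x y) (yt x y) * pdy yt x y) := by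
    rintro f x y h ⟨u, v, hf⟩
    rw [hf.pdx, hf.pdy]
    exact hf.comp (HD.of_smooth hU hxt h) (HD.of_smooth hU hyt h)
  have hAB := fun x y (h : (x, y) ∈ U) => cotton hU (a1 := pdx xt) (a2 := pdy xt) (b1 := pdx yt) (b2 := pdy yt) (s1 := s1) (s2 := s2)
    (p := (fun x y => Pt (xt x y) (yt x y))) (q := (fun x y => Qt (xt x y) (yt x y))) (r := (fun x y => Rt (xt x y) (yt x y))) (w := (fun x y => St (xt x y) (yt x y)))
    (t11 := (fun x y => ric11 Pt Qt Rt (xt x y) (yt x y)))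
    (t111 := (fun x y => pdx (ric11 Pt Qt Rt) (xt x y) (yt x y)))
    (t112 := (fun x y => pdy (ric11 Pt Qt Rt) (xt x y) (yt x y)))
    (t12 := (fun x y => ric12 Pt Qt Rt St (xt x y) (yt x y)))
    (t121 := (fun x y => pdx (ric12 Pt Qt Rt St) (xt x y) (yt x y)))
    (t122 := (fun x y => pdy (ric12 Pt Qt Rt St) (xt x y) (yt x y)))
    (t22 := (fun x y => ric22 Qt Rt St (xt x y) (yt x y)))
    (t221 := (fun x y => pdx (ric22 Qt Rt St) (xt x y) (yt x y)))
    (t222 := (fun x y => pdy (ric22 Qt Rt St) (xt x y) (yt x y)))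
    hs1 hs2 hP hQ hR hS da1 da2 db1 db2
    (fun x y h => hr11 _ x y h ⟨_, _, HD.ric11 hUt hPt hQt hRt (hmaps x y h)⟩)
    (fun x y h => hr11 _ x y h ⟨_, _, HD.ric12 hUt hPt hQt hRt hSt (hmaps x y h)⟩)
    (fun x y h => hr11 _ x y h ⟨_, _, HD.ric22 hUt hQt hRt hSt (hmaps x y h)⟩)
    (fun x y h => (hc x y h).1) (fun x y h => (hc x y h).2.1) (fun x y h => (hc x y h).2.2.1)
    (fun x y h => (hc x y h).2.2.2) h
    (coefA_eq hUt hPt hQt hRt hSt (hmaps x y h)) (coefB_eq hUt hPt hQt hRt hSt (hmaps x y h))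
  have sAt := Smooth2.coefA hUt hPt hQt hRt hSt
  have sBt := Smooth2.coefB hUt hPt hQt hRt hSt
  have hF := fun x y (h : (x, y) ∈ U) => F5law hU (a1 := pdx xt) (a2 := pdy xt) (b1 := pdx yt) (b2 := pdy yt) (s1 := s1) (s2 := s2)
    (p := (fun x y => Pt (xt x y) (yt x y))) (q := (fun x y => Qt (xt x y) (yt x y))) (r := (fun x y => Rt (xt x y) (yt x y))) (w := (fun x y => St (xt x y) (yt x y)))
    (α := (fun x y => coefA Pt Qt Rt St (xt x y) (yt x y)))
    (β := (fun x y => coefB Pt Qt Rt St (xt x y) (yt x y)))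
    (α1 := (fun x y => pdx (coefA Pt Qt Rt St) (xt x y) (yt x y)))
    (α2 := (fun x y => pdy (coefA Pt Qt Rt St) (xt x y) (yt x y)))
    (β1 := (fun x y => pdx (coefB Pt Qt Rt St) (xt x y) (yt x y)))
    (β2 := (fun x y => pdy (coefB Pt Qt Rt St) (xt x y) (yt x y)))
    hP hQ hR hS da1 da2 db1 db2 (hcomp _ sAt) (hcomp _ sBt)
    (fun x y h => (hAB x y h).1) (fun x y h => (hAB x y h).2) h
  have hF5 : ∀ x y, (x, y) ∈ U → coefF5 P Q R S x y =
      (pdx xt x y * pdy yt x y - pdy xt x y * pdx yt x y) ^ 5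
        * coefF5 Pt Qt Rt St (xt x y) (yt x y) := fun x y h => (hF x y h).2.2
  have hfr : ∀ x y, (x, y) ∈ U → frF P Q R S x y =
      (pdx xt x y * pdy yt x y - pdy xt x y * pdx yt x y)
        * frF Pt Qt Rt St (xt x y) (yt x y) := by
    intro x y h
    have h1 := hpos x y h
    have h2 := hpost _ _ (hmaps x y h)
    rw [hF5 x y h] at h1
    have h3 : 0 < (pdx xt x y * pdy yt x y - pdy xt x y * pdx yt x y) ^ 5 :=
      pos_of_mul_pos_left h1 h2.le
    have h4 : 0 < pdx xt x y * pdy yt x y - pdy xt x y * pdx yt x y :=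
      (Odd.pow_pos_iff (by decide)).1 h3
    simp only [frF]
    rw [hF5 x y h, Real.mul_rpow h3.le h2.le, ← Real.rpow_natCast, ← Real.rpow_mul h4.le]
    norm_num
  intro x y h
  have sF := Smooth2.frF hU hP hQ hR hS hpos
  have sFt := Smooth2.frF hUt hPt hQt hRt hSt hpost
  have gF := (HD.of_smooth hU sF h).congr hU ((hF x y h).1.mul (hcomp _ sFt x y h)) h hfr
  have hFne : frF Pt Qt Rt St (xt x y) (yt x y) ≠ 0 :=
    (Real.rpow_pos_of_pos (hpost _ _ (hmaps x y h)) _).ne'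
  simp only [inv6]
  rw [(hF x y h).2.1, gF.1, gF.2, hfr x y h, (hAB x y h).1, (hAB x y h).2]
  exact final_alg (hD x y h) hFne rfl
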